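/- arXiv:1808.09905 — 3 statements merged into one kernel-verified Lean document; each statement's English description precedes it below -/
import Mathlib

section
/- Let C be a category with weak finite limits and binary products, and let X, Y be objects of C. If p₁ : V → U, p₂ : V → X, f : V → Y is a full diagram from X to Y, and s : U × X → V is a section of the canonical retraction (p₁,p₂) : V → U × X, then f s : U × X → Y exhibits U as a weak exponential of Y and X. In particular, a category with binary products and weak finite limits has weak exponentials if it has full diagrams, and a category with finite limits has full diagrams if and only if it has weak exponentials. -/
open CategoryTheory CategoryTheory.Limits

universe v u v₂ u₂

namespace Paper

variable {C : Type u} [Category.{v} C]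

/-- A weak product of `Z` and `X`: every pair of morphisms into `Z` and `X`
factors (not necessarily uniquely) through the projections. -/
def IsWeakProduct {Z X V : C} (p₁ : V ⟶ Z) (p₂ : V ⟶ X) : Prop :=
  ∀ {W : C} (a : W ⟶ Z) (b : W ⟶ X), ∃ t : W ⟶ V, t ≫ p₁ = a ∧ t ≫ p₂ = b

/-- `f` is determined by projections with respect to the span `(p₁, p₂)`. -/
def DeterminedByProjections {Z X V Y : C} (p₁ : V ⟶ Z) (p₂ : V ⟶ X) (f : V ⟶ Y) : Prop :=
  ∀ {W : C} (a b : W ⟶ V), a ≫ p₁ = b ≫ p₁ → a ≫ p₂ = b ≫ p₂ → a ≫ f = b ≫ f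

/-- A weak pullback of `f` and `g` with projections `q₁`, `q₂`. -/
def IsWeakPullback {P A B Z : C} (q₁ : P ⟶ A) (q₂ : P ⟶ B) (f : A ⟶ Z) (g : B ⟶ Z) : Prop :=
  q₁ ≫ f = q₂ ≫ g ∧
    ∀ {W : C} (a : W ⟶ A) (b : W ⟶ B), a ≫ f = b ≫ g →
      ∃ t : W ⟶ P, t ≫ q₁ = a ∧ t ≫ q₂ = b

/-- `(W, p₁ : V ⟶ W, p₂ : V ⟶ X, e : V ⟶ Y)` is a weak exponential of `Y` and `X`. -/
def IsWeakExponential {X Y W V : C} (p₁ : V ⟶ W) (p₂ : V ⟶ X) (e : V ⟶ Y) : Prop :=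
  IsWeakProduct p₁ p₂ ∧ DeterminedByProjections p₁ p₂ e ∧
    ∀ {W' V' : C} (p₁' : V' ⟶ W') (p₂' : V' ⟶ X) (e' : V' ⟶ Y),
      IsWeakProduct p₁' p₂' → DeterminedByProjections p₁' p₂' e' →
        ∃ (h : W' ⟶ W) (k : V' ⟶ V), k ≫ p₁ = p₁' ≫ h ∧ k ≫ p₂ = p₂' ∧ k ≫ e = e'

/-- A full diagram from `X` to `Y`. -/
def IsFullDiagram {X Y U V : C} (p₁ : V ⟶ U) (p₂ : V ⟶ X) (f : V ⟶ Y) : Prop :=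
  IsWeakProduct p₁ p₂ ∧
    ∀ {U' V' : C} (p₁' : V' ⟶ U') (p₂' : V' ⟶ X) (f' : V' ⟶ Y), IsWeakProduct p₁' p₂' →
      ∃ (h : U' ⟶ U) (P : C) (q₁ : P ⟶ U') (q₂ : P ⟶ V) (k : P ⟶ V'),
        IsWeakPullback q₁ q₂ h p₁ ∧ k ≫ p₁' = q₁ ∧ k ≫ p₂' = q₂ ≫ p₂ ∧ k ≫ f' = q₂ ≫ f

def HasFullDiagrams (C : Type u) [Category.{v} C] : Prop :=
  ∀ X Y : C, ∃ (U V : C) (p₁ : V ⟶ U) (p₂ : V ⟶ X) (f : V ⟶ Y), IsFullDiagram p₁ p₂ f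

def HasWeakExponentials (C : Type u) [Category.{v} C] : Prop :=
  ∀ X Y : C, ∃ (W V : C) (p₁ : V ⟶ W) (p₂ : V ⟶ X) (e : V ⟶ Y), IsWeakExponential p₁ p₂ e

/-- A dependent full diagram over `x : X ⟶ J` and `y : Y ⟶ X`. -/
def IsDepFullDiagram {J X Y U V : C} (x : X ⟶ J) (y : Y ⟶ X)
    (u : U ⟶ J) (p₁ : V ⟶ U) (p₂ : V ⟶ X) (f : V ⟶ Y) : Prop :=
  IsWeakPullback p₁ p₂ u x ∧ f ≫ y = p₂ ∧
    ∀ {U' V' : C} (u' : U' ⟶ J) (p₁' : V' ⟶ U') (p₂' : V' ⟶ X) (f' : V' ⟶ Y),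
      IsWeakPullback p₁' p₂' u' x → f' ≫ y = p₂' →
        ∃ h : U' ⟶ U, h ≫ u = u' ∧
          ∃ (P : C) (q₁ : P ⟶ V) (q₂ : P ⟶ U') (k : P ⟶ V'),
            IsWeakPullback q₁ q₂ p₁ h ∧ k ≫ p₁' = q₂ ∧ k ≫ f' = q₁ ≫ f

/-- A weak dependent product of `y : Y ⟶ X` and `x : X ⟶ J`. -/
def IsWeakDepProd {J X Y U V : C} (x : X ⟶ J) (y : Y ⟶ X)
    (u : U ⟶ J) (p₁ : V ⟶ U) (p₂ : V ⟶ X) (f : V ⟶ Y) : Prop :=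
  IsWeakPullback p₁ p₂ u x ∧ f ≫ y = p₂ ∧ DeterminedByProjections p₁ p₂ f ∧
    ∀ {U' V' : C} (u' : U' ⟶ J) (p₁' : V' ⟶ U') (p₂' : V' ⟶ X) (f' : V' ⟶ Y),
      IsWeakPullback p₁' p₂' u' x → f' ≫ y = p₂' →
        ∃ (h : U' ⟶ U) (k : V' ⟶ V),
          h ≫ u = u' ∧ k ≫ p₁ = p₁' ≫ h ∧ k ≫ p₂ = p₂' ∧ k ≫ f = f'

def HasDepFullDiagrams (C : Type u) [Category.{v} C] : Prop :=
  ∀ {J X Y : C} (x : X ⟶ J) (y : Y ⟶ X),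
    ∃ (U V : C) (u : U ⟶ J) (p₁ : V ⟶ U) (p₂ : V ⟶ X) (f : V ⟶ Y),
      IsDepFullDiagram x y u p₁ p₂ f

def HasWeakDepProds (C : Type u) [Category.{v} C] : Prop :=
  ∀ {J X Y : C} (x : X ⟶ J) (y : Y ⟶ X),
    ∃ (U V : C) (u : U ⟶ J) (p₁ : V ⟶ U) (p₂ : V ⟶ X) (f : V ⟶ Y),
      IsWeakDepProd x y u p₁ p₂ f

/-- A category has weak finite limits if every finite diagram admits a weak limit,
i.e. a cone through which every cone factors (not necessarily uniquely). -/
def HasWeakFiniteLimits (C : Type u) [Category.{v} C] : Prop :=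
  ∀ (J : Type) (_ : SmallCategory J) (_ : FinCategory J) (F : J ⥤ C),
    ∃ c : Cone F, ∀ d : Cone F, Nonempty (d ⟶ c)

end Paper
namespace Paper

section

variable {C : Type u} [Category.{v} C] [HasBinaryProducts C]

attribute [local simp] prod.lift_fst prod.lift_snd prod.lift_fst_assoc

theorem isWeakProduct_prod (Z X : C) :
    IsWeakProduct (prod.fst : (Z ⨯ X : C) ⟶ Z) (prod.snd : (Z ⨯ X : C) ⟶ X) :=
  fun a b => ⟨prod.lift a b, prod.lift_fst a b, prod.lift_snd a b⟩

theorem determinedByProjections_prod {Z X Y : C} (g : (Z ⨯ X : C) ⟶ Y) :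
    DeterminedByProjections prod.fst prod.snd g := by
  intro W a b h₁ h₂
  rw [prod.hom_ext h₁ h₂]

theorem IsWeakProduct.exists_section {Z X V : C} {p₁ : V ⟶ Z} {p₂ : V ⟶ X}
    (h : IsWeakProduct p₁ p₂) : ∃ s : (Z ⨯ X : C) ⟶ V, s ≫ prod.lift p₁ p₂ = 𝟙 (Z ⨯ X) := by
  obtain ⟨s, h₁, h₂⟩ := h (prod.fst : (Z ⨯ X : C) ⟶ Z) prod.snd
  exact ⟨s, by ext <;> simp [h₁, h₂]⟩

theorem isWeakPullback_lift_fst {U' U : C} (h : U' ⟶ U) (X : C) :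
    IsWeakPullback (prod.fst : (U' ⨯ X : C) ⟶ U') (prod.lift (prod.fst ≫ h) prod.snd) h
      (prod.fst : (U ⨯ X : C) ⟶ U) := by
  refine ⟨by simp, fun a b hab => ⟨prod.lift a (b ≫ prod.snd), by simp, ?_⟩⟩
  ext <;> simp [hab]

theorem IsFullDiagram.isWeakExponential {X Y U V : C} {p₁ : V ⟶ U} {p₂ : V ⟶ X} {f : V ⟶ Y}
    (hfd : IsFullDiagram p₁ p₂ f)
    (s : (U ⨯ X : C) ⟶ V) (hs : s ≫ prod.lift p₁ p₂ = 𝟙 (U ⨯ X)) :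
    IsWeakExponential (prod.fst : (U ⨯ X : C) ⟶ U) (prod.snd : (U ⨯ X : C) ⟶ X) (s ≫ f) := by
  have hs₁ : s ≫ p₁ = prod.fst := by simpa using hs =≫ prod.fst
  have hs₂ : s ≫ p₂ = prod.snd := by simpa using hs =≫ prod.snd
  refine ⟨isWeakProduct_prod U X, determinedByProjections_prod _, ?_⟩
  intro W' V' p₁' p₂' e' hw hd
  obtain ⟨h, P, q₁, q₂, k, hP, hk₁, hk₂, hkf⟩ := hfd.2 p₁' p₂' e' hw
  obtain ⟨t, ht₁, ht₂⟩ := hP.2 p₁' (prod.lift (p₁' ≫ h) p₂' ≫ s) (by simp [hs₁])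
  refine ⟨h, prod.lift (p₁' ≫ h) p₂', by simp, by simp, ?_⟩
  calc prod.lift (p₁' ≫ h) p₂' ≫ s ≫ f = (t ≫ k) ≫ e' := by
        rw [Category.assoc, hkf, reassoc_of% ht₂]
    _ = 𝟙 V' ≫ e' := by
        refine hd _ _ ?_ ?_
        · simp [hk₁, ht₁]
        · simp [hk₂, reassoc_of% ht₂, hs₂]
    _ = e' := Category.id_comp e'

theorem IsWeakExponential.isFullDiagram {X Y W V : C} {p₁ : V ⟶ W} {p₂ : V ⟶ X} {e : V ⟶ Y}
    (hwe : IsWeakExponential p₁ p₂ e)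
    (s : (W ⨯ X : C) ⟶ V) (hs : s ≫ prod.lift p₁ p₂ = 𝟙 (W ⨯ X)) :
    IsFullDiagram (prod.fst : (W ⨯ X : C) ⟶ W) (prod.snd : (W ⨯ X : C) ⟶ X) (s ≫ e) := by
  have hs₁ : s ≫ p₁ = prod.fst := by simpa using hs =≫ prod.fst
  have hs₂ : s ≫ p₂ = prod.snd := by simpa using hs =≫ prod.snd
  refine ⟨isWeakProduct_prod W X, ?_⟩
  intro U' V' p₁' p₂' f' hw
  obtain ⟨s', hs₁', hs₂'⟩ := hw (prod.fst : (U' ⨯ X : C) ⟶ U') prod.snd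
  obtain ⟨h, k, hk₁, hk₂, hke⟩ := hwe.2.2 prod.fst prod.snd (s' ≫ f')
    (isWeakProduct_prod U' X) (determinedByProjections_prod _)
  refine ⟨h, U' ⨯ X, prod.fst, prod.lift (prod.fst ≫ h) prod.snd, s',
    isWeakPullback_lift_fst h X, hs₁', by simp [hs₂'], ?_⟩
  rw [← hke, ← Category.assoc]
  exact hwe.2.1 _ _ (by simp [hk₁, hs₁]) (by simp [hk₂, hs₂])

theorem HasFullDiagrams.hasWeakExponentials (H : HasFullDiagrams C) : HasWeakExponentials C := by
  intro X Y
  obtain ⟨U, V, p₁, p₂, f, hfd⟩ := H X Y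
  obtain ⟨s, hs⟩ := IsWeakProduct.exists_section hfd.1
  exact ⟨U, U ⨯ X, prod.fst, prod.snd, s ≫ f, hfd.isWeakExponential s hs⟩

theorem HasWeakExponentials.hasFullDiagrams (H : HasWeakExponentials C) : HasFullDiagrams C := by
  intro X Y
  obtain ⟨W, V, p₁, p₂, e, hwe⟩ := H X Y
  obtain ⟨s, hs⟩ := IsWeakProduct.exists_section hwe.1
  exact ⟨W, W ⨯ X, prod.fst, prod.snd, s ≫ e, hwe.isFullDiagram s hs⟩

end

/-- If `(p₁, p₂, f)` is a full diagram from `X` to `Y` in a category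
with binary products and weak finite limits, and `s` is a section of the canonical
retraction `(p₁, p₂) : V ⟶ U ⨯ X`, then `s ≫ f : U ⨯ X ⟶ Y` exhibits `U` as a weak
exponential of `Y` and `X`.  In particular a category with binary products and weak
finite limits with full diagrams has weak exponentials, and a category with finite
limits has full diagrams iff it has weak exponentials. -/
theorem fullDiagram_gives_weakExponential
    {C : Type u} [Category.{v} C] [HasBinaryProducts C]
    (hwfl : HasWeakFiniteLimits C) {X Y U V : C}
    (p₁ : V ⟶ U) (p₂ : V ⟶ X) (f : V ⟶ Y)
    (hfd : IsFullDiagram p₁ p₂ f)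
    (s : (U ⨯ X : C) ⟶ V) (hs : s ≫ prod.lift p₁ p₂ = 𝟙 (U ⨯ X)) :
    IsWeakExponential (prod.fst : (U ⨯ X : C) ⟶ U) (prod.snd : (U ⨯ X : C) ⟶ X) (s ≫ f) ∧
    (HasFullDiagrams C → HasWeakExponentials C) ∧
    (∀ (D : Type u₂) (instD : Category.{v₂} D), @HasFiniteLimits D instD →
      (@HasFullDiagrams D instD ↔ @HasWeakExponentials D instD)) := by
  refine ⟨hfd.isWeakExponential s hs, HasFullDiagrams.hasWeakExponentials, ?_⟩
  intro D instD hD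
  exact ⟨HasFullDiagrams.hasWeakExponentials, HasWeakExponentials.hasFullDiagrams⟩

end Paper
end

section
/- Let E be an exact category with a projective cover P. If P has right adjoints to weak pullback functors and P has full diagrams, then E is cartesian closed. (Equivalently: if a category C with weak finite limits has right adjoints to weak pullback functors and full diagrams, then its exact completion C_ex is cartesian closed.) -/
open CategoryTheory CategoryTheory.Limits

universe v u v₂ u₂

namespace Paper

variable {E : Type u} [Category.{v} E]

/-- An internal equivalence relation, expressed via generalized elements:
the pair `(r₁, r₂)` is jointly monic, reflexive, symmetric and transitive. -/
def IsInternalEquivRel {R X : E} (r₁ r₂ : R ⟶ X) : Prop :=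
  (∀ {W : E} (a b : W ⟶ R), a ≫ r₁ = b ≫ r₁ → a ≫ r₂ = b ≫ r₂ → a = b) ∧
  (∀ {W : E} (x : W ⟶ X), ∃ d : W ⟶ R, d ≫ r₁ = x ∧ d ≫ r₂ = x) ∧
  (∀ {W : E} (a : W ⟶ R), ∃ b : W ⟶ R, b ≫ r₁ = a ≫ r₂ ∧ b ≫ r₂ = a ≫ r₁) ∧
  (∀ {W : E} (a b : W ⟶ R), a ≫ r₂ = b ≫ r₁ →
    ∃ c : W ⟶ R, c ≫ r₁ = a ≫ r₁ ∧ c ≫ r₂ = b ≫ r₂)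

/-- A Barr-exact category: a regular category (finite limits together with
pullback-stable regular epi–mono factorisations) in which every internal
equivalence relation is effective (is a kernel pair). -/
class ExactCategory (E : Type u) [Category.{v} E] : Prop where
  hasFiniteLimits : HasFiniteLimits E
  regEpiMonoFactorisation : ∀ {A B : E} (f : A ⟶ B),
    ∃ (I : E) (e : A ⟶ I) (m : I ⟶ B), Nonempty (RegularEpi e) ∧ Mono m ∧ e ≫ m = f
  regEpiStable : ∀ {A B X P : E} (f : A ⟶ B) (g : X ⟶ B) (p₁ : P ⟶ A) (p₂ : P ⟶ X),
    IsPullback p₁ p₂ f g → Nonempty (RegularEpi f) → Nonempty (RegularEpi p₂)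
  equivRelEffective : ∀ {R X : E} (r₁ r₂ : R ⟶ X), IsInternalEquivRel r₁ r₂ →
    ∃ (Y : E) (q : X ⟶ Y), IsKernelPair q r₁ r₂

attribute [instance] ExactCategory.hasFiniteLimits

/-- `P` is (the object class of) a projective cover of `E`: every object satisfying `P`
is regular projective and every object of `E` is covered by a regular epi from an
object satisfying `P`. -/
def IsProjectiveCover (P : E → Prop) : Prop :=
  (∀ {X : E}, P X → ∀ {A B : E} (g : A ⟶ B), Nonempty (RegularEpi g) →
    ∀ f : X ⟶ B, ∃ f' : X ⟶ A, f' ≫ g = f) ∧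
  (∀ A : E, ∃ (X : E) (p : X ⟶ A), P X ∧ Nonempty (RegularEpi p))

section Relative

variable (P : E → Prop)

/-- Weak product relative to the full subcategory on `P`. -/
def IsWeakProductOn {Z X V : E} (p₁ : V ⟶ Z) (p₂ : V ⟶ X) : Prop :=
  ∀ {W : E}, P W → ∀ (a : W ⟶ Z) (b : W ⟶ X), ∃ t : W ⟶ V, t ≫ p₁ = a ∧ t ≫ p₂ = b

/-- Determined by projections, relative to the full subcategory on `P`. -/
def DeterminedByProjectionsOn {Z X V Y : E} (p₁ : V ⟶ Z) (p₂ : V ⟶ X) (f : V ⟶ Y) : Prop :=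
  ∀ {W : E}, P W → ∀ (a b : W ⟶ V), a ≫ p₁ = b ≫ p₁ → a ≫ p₂ = b ≫ p₂ → a ≫ f = b ≫ f

/-- Weak pullback relative to the full subcategory on `P`. -/
def IsWeakPullbackOn {Q A B Z : E} (q₁ : Q ⟶ A) (q₂ : Q ⟶ B) (f : A ⟶ Z) (g : B ⟶ Z) : Prop :=
  q₁ ≫ f = q₂ ≫ g ∧
    ∀ {W : E}, P W → ∀ (a : W ⟶ A) (b : W ⟶ B), a ≫ f = b ≫ g →
      ∃ t : W ⟶ Q, t ≫ q₁ = a ∧ t ≫ q₂ = b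

/-- Full diagram from `X` to `Y` relative to the full subcategory on `P`. -/
def IsFullDiagramOn {X Y U V : E} (p₁ : V ⟶ U) (p₂ : V ⟶ X) (f : V ⟶ Y) : Prop :=
  IsWeakProductOn P p₁ p₂ ∧
    ∀ {U' V' : E}, P U' → P V' → ∀ (p₁' : V' ⟶ U') (p₂' : V' ⟶ X) (f' : V' ⟶ Y),
      IsWeakProductOn P p₁' p₂' →
        ∃ (h : U' ⟶ U) (Q : E) (_ : P Q) (q₁ : Q ⟶ U') (q₂ : Q ⟶ V) (k : Q ⟶ V'),
          IsWeakPullbackOn P q₁ q₂ h p₁ ∧ k ≫ p₁' = q₁ ∧ k ≫ p₂' = q₂ ≫ p₂ ∧ k ≫ f' = q₂ ≫ f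

/-- The full subcategory on `P` has full diagrams. -/
def HasFullDiagramsOn : Prop :=
  ∀ {X Y : E}, P X → P Y →
    ∃ (U V : E) (_ : P U) (_ : P V) (p₁ : V ⟶ U) (p₂ : V ⟶ X) (f : V ⟶ Y),
      IsFullDiagramOn P p₁ p₂ f

/-- Weak exponential relative to the full subcategory on `P`. -/
def IsWeakExponentialOn {X Y W V : E} (p₁ : V ⟶ W) (p₂ : V ⟶ X) (e : V ⟶ Y) : Prop :=
  IsWeakProductOn P p₁ p₂ ∧ DeterminedByProjectionsOn P p₁ p₂ e ∧
    ∀ {W' V' : E}, P W' → P V' → ∀ (p₁' : V' ⟶ W') (p₂' : V' ⟶ X) (e' : V' ⟶ Y),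
      IsWeakProductOn P p₁' p₂' → DeterminedByProjectionsOn P p₁' p₂' e' →
        ∃ (h : W' ⟶ W) (k : V' ⟶ V), k ≫ p₁ = p₁' ≫ h ∧ k ≫ p₂ = p₂' ∧ k ≫ e = e'

/-- The full subcategory on `P` has weak exponentials. -/
def HasWeakExponentialsOn : Prop :=
  ∀ {X Y : E}, P X → P Y →
    ∃ (W V : E) (_ : P W) (_ : P V) (p₁ : V ⟶ W) (p₂ : V ⟶ X) (e : V ⟶ Y),
      IsWeakExponentialOn P p₁ p₂ e

/-- Dependent full diagram relative to the full subcategory on `P`. -/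
def IsDepFullDiagramOn {J X Y U V : E} (x : X ⟶ J) (y : Y ⟶ X)
    (u : U ⟶ J) (p₁ : V ⟶ U) (p₂ : V ⟶ X) (f : V ⟶ Y) : Prop :=
  IsWeakPullbackOn P p₁ p₂ u x ∧ f ≫ y = p₂ ∧
    ∀ {U' V' : E}, P U' → P V' → ∀ (u' : U' ⟶ J) (p₁' : V' ⟶ U') (p₂' : V' ⟶ X) (f' : V' ⟶ Y),
      IsWeakPullbackOn P p₁' p₂' u' x → f' ≫ y = p₂' →
        ∃ h : U' ⟶ U, h ≫ u = u' ∧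
          ∃ (Q : E) (_ : P Q) (q₁ : Q ⟶ V) (q₂ : Q ⟶ U') (k : Q ⟶ V'),
            IsWeakPullbackOn P q₁ q₂ p₁ h ∧ k ≫ p₁' = q₂ ∧ k ≫ f' = q₁ ≫ f

/-- The full subcategory on `P` has dependent full diagrams. -/
def HasDepFullDiagramsOn : Prop :=
  ∀ {J X Y : E}, P J → P X → P Y → ∀ (x : X ⟶ J) (y : Y ⟶ X),
    ∃ (U V : E) (_ : P U) (_ : P V) (u : U ⟶ J) (p₁ : V ⟶ U) (p₂ : V ⟶ X) (f : V ⟶ Y),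
      IsDepFullDiagramOn P x y u p₁ p₂ f

/-- Weak dependent product relative to the full subcategory on `P`. -/
def IsWeakDepProdOn {J X Y U V : E} (x : X ⟶ J) (y : Y ⟶ X)
    (u : U ⟶ J) (p₁ : V ⟶ U) (p₂ : V ⟶ X) (f : V ⟶ Y) : Prop :=
  IsWeakPullbackOn P p₁ p₂ u x ∧ f ≫ y = p₂ ∧ DeterminedByProjectionsOn P p₁ p₂ f ∧
    ∀ {U' V' : E}, P U' → P V' → ∀ (u' : U' ⟶ J) (p₁' : V' ⟶ U') (p₂' : V' ⟶ X) (f' : V' ⟶ Y),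
      IsWeakPullbackOn P p₁' p₂' u' x → f' ≫ y = p₂' →
        ∃ (h : U' ⟶ U) (k : V' ⟶ V),
          h ≫ u = u' ∧ k ≫ p₁ = p₁' ≫ h ∧ k ≫ p₂ = p₂' ∧ k ≫ f = f'

/-- The full subcategory on `P` has weak dependent products. -/
def HasWeakDepProdsOn : Prop :=
  ∀ {J X Y : E}, P J → P X → P Y → ∀ (x : X ⟶ J) (y : Y ⟶ X),
    ∃ (U V : E) (_ : P U) (_ : P V) (u : U ⟶ J) (p₁ : V ⟶ U) (p₂ : V ⟶ X) (f : V ⟶ Y),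
      IsWeakDepProdOn P x y u p₁ p₂ f

/-- An object over `X` with vertex in the full subcategory on `P`. -/
structure OverIn (X : E) where
  V : E
  hV : P V
  hom : V ⟶ X

/-- The preorder on `OverIn P X` whose poset reflection is the poset reflection
of the slice category of the full subcategory on `P` over `X`. -/
instance {X : E} : Preorder (OverIn P X) where
  le a b := ∃ t : a.V ⟶ b.V, t ≫ b.hom = a.hom
  le_refl a := ⟨𝟙 _, by simp⟩
  le_trans a b c := by
    rintro ⟨t, ht⟩ ⟨s, hs⟩
    exact ⟨t ≫ s, by simp [Category.assoc, hs, ht]⟩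

/-- The full subcategory on `P` has right adjoints to the (poset-reflected)
weak pullback functors along all of its morphisms. -/
def HasRightAdjointsToWeakPullbacksOn : Prop :=
  ∀ {X Y : E}, P X → P Y → ∀ f : Y ⟶ X,
    ∃ wp : OverIn P X → OverIn P Y,
      (∀ a : OverIn P X, ∃ m : (wp a).V ⟶ a.V,
        IsWeakPullbackOn P m (wp a).hom a.hom f) ∧
      ∃ ra : OverIn P Y → OverIn P X,
        ∀ (a : OverIn P X) (b : OverIn P Y), wp a ≤ b ↔ a ≤ ra b

end Relative

/-- `ev : W ⨯ X ⟶ Y` exhibits `W` as an exponential of `Y` by `X`. -/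
def IsExponential [HasBinaryProducts E] (X Y W : E) (ev : W ⨯ X ⟶ Y) : Prop :=
  ∀ {Z : E} (g : Z ⨯ X ⟶ Y), ∃! h : Z ⟶ W, prod.map h (𝟙 X) ≫ ev = g

/-- A category with binary products is cartesian closed if every pair of objects
has an exponential. -/
def IsCartesianClosed (E : Type u) [Category.{v} E] [HasBinaryProducts E] : Prop :=
  ∀ X Y : E, ∃ (W : E) (ev : W ⨯ X ⟶ Y), IsExponential X Y W ev

/-- A category with finite limits is locally cartesian closed if all its slices
are cartesian closed. -/
def IsLocallyCartesianClosed (E : Type u) [Category.{v} E] [HasFiniteLimits E] : Prop :=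
  ∀ X : E, IsCartesianClosed (Over X)

end Paper
namespace Paper

attribute [local simp] prod.lift_fst prod.lift_snd prod.lift_fst_assoc prod.lift_snd_assoc
  pullback.lift_fst pullback.lift_snd pullback.lift_fst_assoc pullback.lift_snd_assoc

section ProjectiveCover

variable {E : Type u} [Category.{v} E] {P : E → Prop}

/-- Every object is covered by an object of `P` along which maps from `P` lift. -/
lemma IsProjectiveCover.exists_cover (hP : IsProjectiveCover P) (A : E) :
    ∃ (X : E) (p : X ⟶ A), P X ∧ Nonempty (RegularEpi p) ∧
      ∀ {T : E}, P T → ∀ f : T ⟶ A, ∃ f' : T ⟶ X, f' ≫ p = f := by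
  obtain ⟨X, p, hX, hp⟩ := hP.2 A
  exact ⟨X, p, hX, hp, fun hT f => hP.1 hT p hp f⟩

lemma IsProjectiveCover.hom_ext (hP : IsProjectiveCover P) {A B : E} {f g : A ⟶ B}
    (h : ∀ {T : E}, P T → ∀ t : T ⟶ A, t ≫ f = t ≫ g) : f = g := by
  obtain ⟨X, p, hX, ⟨hp⟩, -⟩ := hP.exists_cover A
  have := hp.epi
  exact (cancel_epi p).1 (h hX p)

lemma IsProjectiveCover.exists_factor (hP : IsProjectiveCover P) {A M B : E} (m : M ⟶ B)
    [Mono m] (f : A ⟶ B)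
    (h : ∀ {T : E}, P T → ∀ t : T ⟶ A, ∃ l : T ⟶ M, l ≫ m = t ≫ f) :
    ∃ l : A ⟶ M, l ≫ m = f := by
  obtain ⟨X, p, hX, ⟨hp⟩, -⟩ := hP.exists_cover A
  obtain ⟨l, hl⟩ := h hX p
  have := hp.epi
  obtain ⟨d, hd⟩ := hp.desc' l (by
    rw [← cancel_mono m, Category.assoc, Category.assoc, hl, ← Category.assoc, hp.w,
      Category.assoc])
  refine ⟨d, (cancel_epi p).1 ?_⟩
  rw [← Category.assoc, hd, hl]

/-- A functional relation between `P`-points, stable under reindexing, is the graph of a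
morphism. -/
lemma IsProjectiveCover.exists_hom_of_functional (hP : IsProjectiveCover P) {A B : E}
    (ρ : ∀ {T : E}, (T ⟶ A) → (T ⟶ B) → Prop)
    (stable : ∀ {S T : E}, P S → P T → ∀ (i : S ⟶ T) (a : T ⟶ A) (b : T ⟶ B),
      ρ a b → ρ (i ≫ a) (i ≫ b))
    (total : ∀ {T : E}, P T → ∀ a : T ⟶ A, ∃ b : T ⟶ B, ρ a b)
    (unique : ∀ {T : E}, P T → ∀ (a : T ⟶ A) (b b' : T ⟶ B), ρ a b → ρ a b' → b = b') :
    ∃ f : A ⟶ B, ∀ {T : E}, P T → ∀ (a : T ⟶ A) (b : T ⟶ B), ρ a b → a ≫ f = b := by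
  obtain ⟨X, p, hX, ⟨hp⟩, hlift⟩ := hP.exists_cover A
  obtain ⟨b, hb⟩ := total hX p
  obtain ⟨f, hf⟩ := hp.desc' b (hP.hom_ext fun {T} hT t => by
    have h₁ := stable hT hX (t ≫ hp.left) p b hb
    have h₂ := stable hT hX (t ≫ hp.right) p b hb
    rw [Category.assoc, hp.w, ← Category.assoc] at h₁
    simpa using unique hT _ _ _ h₁ h₂)
  refine ⟨f, fun {T} hT a b' hab => ?_⟩
  obtain ⟨a', rfl⟩ := hlift hT a
  rw [Category.assoc, hf]
  exact unique hT _ _ _ (stable hT hX a' p b hb) hab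

/-- Every morphism has the same `P`-points in its image as it has itself. -/
lemma IsProjectiveCover.exists_image [ExactCategory E] (hP : IsProjectiveCover P) {A B : E}
    (f : A ⟶ B) :
    ∃ (M : E) (m : M ⟶ B), Mono m ∧
      ∀ {T : E}, P T → ∀ t : T ⟶ B, (∃ l, l ≫ m = t) ↔ ∃ l, l ≫ f = t := by
  obtain ⟨M, e, m, he, hm, rfl⟩ := ExactCategory.regEpiMonoFactorisation f
  refine ⟨M, m, hm, fun {T} hT t => ⟨?_, ?_⟩⟩
  · rintro ⟨l, rfl⟩
    obtain ⟨l', rfl⟩ := hP.1 hT e he l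
    exact ⟨l', by simp⟩
  · rintro ⟨l, rfl⟩
    exact ⟨l ≫ e, by simp⟩

/-- Universal quantification along an arbitrary morphism `π : K ⟶ G` of the image of
`s : S ⟶ K`. -/
lemma HasRightAdjointsToWeakPullbacksOn.exists_forall [ExactCategory E]
    (hP : IsProjectiveCover P) (hadj : HasRightAdjointsToWeakPullbacksOn P)
    {S K G : E} (s : S ⟶ K) (π : K ⟶ G) :
    ∃ (M : E) (m : M ⟶ G), Mono m ∧ ∀ {T : E}, P T → ∀ t : T ⟶ G, (∃ l, l ≫ m = t) ↔
      ∀ {W : E}, P W → ∀ (w : W ⟶ T) (k : W ⟶ K), w ≫ t = k ≫ π → ∃ l, l ≫ s = k := by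
  obtain ⟨G', c, hG', -, hc⟩ := hP.exists_cover G
  obtain ⟨K', d, hK', -, hd⟩ := hP.exists_cover (pullback c π)
  obtain ⟨S', e, hS', -, he⟩ := hP.exists_cover (pullback (d ≫ pullback.snd c π) s)
  obtain ⟨wp, hwp, ra, hra⟩ := hadj hG' hK' (d ≫ pullback.fst c π)
  let b : OverIn P K' := ⟨S', hS', e ≫ pullback.fst _ _⟩
  obtain ⟨M, m, hm, himg⟩ := hP.exists_image ((ra b).hom ≫ c)
  refine ⟨M, m, hm, fun {T} hT t => (himg hT t).trans ⟨?_, ?_⟩⟩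
  · rintro ⟨l, rfl⟩ W hW w k hk
    let a : OverIn P G' := ⟨T, hT, l ≫ (ra b).hom⟩
    obtain ⟨r, hr⟩ := (hra a b).2 ⟨l, rfl⟩
    obtain ⟨n, -, hn⟩ := hwp a
    obtain ⟨k', hk'⟩ := hd hW (pullback.lift (w ≫ l ≫ (ra b).hom) k (by simpa using hk))
    obtain ⟨j, -, hj⟩ := hn hW w k' (by simp [a, reassoc_of% hk'])
    refine ⟨j ≫ r ≫ e ≫ pullback.snd _ _, ?_⟩
    have hr' : r ≫ e ≫ pullback.fst _ _ = (wp a).hom := hr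
    rw [Category.assoc, Category.assoc, Category.assoc, ← pullback.condition,
      reassoc_of% hr', reassoc_of% hj, reassoc_of% hk', pullback.lift_snd]
  · intro h
    obtain ⟨t', rfl⟩ := hc hT t
    let a : OverIn P G' := ⟨T, hT, t'⟩
    obtain ⟨n, hn, -⟩ := hwp a
    have hn' : n ≫ t' = (wp a).hom ≫ d ≫ pullback.fst c π := hn
    obtain ⟨l, hl⟩ := h (wp a).hV n ((wp a).hom ≫ d ≫ pullback.snd c π) (by
      rw [reassoc_of% hn']; simp [pullback.condition])
    obtain ⟨r, hr⟩ := he (wp a).hV (pullback.lift (wp a).hom l (by simpa using hl.symm))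
    obtain ⟨q, hq⟩ := (hra a b).1 ⟨r, by
      change r ≫ e ≫ pullback.fst _ _ = _
      rw [reassoc_of% hr, pullback.lift_fst]⟩
    have hqt : q ≫ (ra b).hom = t' := hq
    exact ⟨q, by rw [reassoc_of% hqt]⟩

/-- A partial equivalence relation on the `P`-points of `U`, classified by a subobject of
`U ⨯ U`, has a quotient. -/
lemma IsProjectiveCover.exists_subquotient [ExactCategory E] (hP : IsProjectiveCover P) {U : E}
    (r : ∀ {T : E}, (T ⟶ U) → (T ⟶ U) → Prop) {M : E} (m : M ⟶ U ⨯ U) [Mono m]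
    (hm : ∀ {T : E}, P T → ∀ a b : T ⟶ U, (∃ l, l ≫ m = prod.lift a b) ↔ r a b)
    (symm : ∀ {T : E}, P T → ∀ a b : T ⟶ U, r a b → r b a)
    (trans : ∀ {T : E}, P T → ∀ a b c : T ⟶ U, r a b → r b c → r a c) :
    ∃ (U₀ W : E) (i : U₀ ⟶ U) (q : U₀ ⟶ W), Nonempty (RegularEpi q) ∧
      (∀ {T : E}, P T → ∀ a : T ⟶ U, r a a → ∃ l, l ≫ i = a) ∧
      ∀ {T : E}, P T → ∀ a b : T ⟶ U₀, a ≫ q = b ≫ q ↔ r (a ≫ i) (b ≫ i) := by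
  let i : pullback m (diag U) ⟶ U := pullback.snd m (diag U)
  have hi {T : E} (hT : P T) (a : T ⟶ U) : (∃ l, l ≫ i = a) ↔ r a a := by
    rw [← hm hT]
    constructor
    · rintro ⟨l, rfl⟩
      refine ⟨l ≫ pullback.fst _ _, ?_⟩
      rw [Category.assoc, pullback.condition]
      ext <;> simp [i]
    · rintro ⟨l, hl⟩
      exact ⟨pullback.lift l a (by rw [hl]; ext <;> simp), by simp [i]⟩
  have : Mono i := inferInstance
  clear_value i
  generalize pullback m (diag U) = U₀ at i
  let R := pullback m (prod.map i i)
  let s : R ⟶ U₀ ⨯ U₀ := pullback.snd m (prod.map i i)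
  have hs {T : E} (hT : P T) (a b : T ⟶ U₀) :
      (∃ l, l ≫ s = prod.lift a b) ↔ r (a ≫ i) (b ≫ i) := by
    rw [← hm hT]
    constructor
    · rintro ⟨l, hl⟩
      refine ⟨l ≫ pullback.fst _ _, ?_⟩
      rw [Category.assoc, pullback.condition, ← Category.assoc]
      change (l ≫ s) ≫ _ = _
      rw [hl]
      ext <;> simp
    · rintro ⟨l, hl⟩
      exact ⟨pullback.lift l (prod.lift a b) (by rw [hl]; ext <;> simp), by simp [s]⟩
  have hsm : Mono s := inferInstance
  clear_value s
  have hs' {T : E} (hT : P T) (l : T ⟶ R) :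
      r ((l ≫ s ≫ prod.fst) ≫ i) ((l ≫ s ≫ prod.snd) ≫ i) :=
    (hs hT _ _).1 ⟨l, by ext <;> simp⟩
  have key {A : E} (a b : A ⟶ U₀)
      (h : ∀ {T : E}, P T → ∀ t : T ⟶ A, r ((t ≫ a) ≫ i) ((t ≫ b) ≫ i)) :
      ∃ l : A ⟶ R, l ≫ s ≫ prod.fst = a ∧ l ≫ s ≫ prod.snd = b := by
    obtain ⟨l, hl⟩ := hP.exists_factor s (prod.lift a b) fun {T} hT t => by
      obtain ⟨l, hl⟩ := (hs hT _ _).2 (h hT t)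
      exact ⟨l, by rw [hl]; ext <;> simp⟩
    exact ⟨l, by rw [reassoc_of% hl]; simp, by rw [reassoc_of% hl]; simp⟩
  obtain ⟨W', q', hq'⟩ := ExactCategory.equivRelEffective (s ≫ prod.fst) (s ≫ prod.snd)
    ⟨fun a b h₁ h₂ => by
        rw [← cancel_mono s]
        ext
        · simpa using h₁
        · simpa using h₂,
      fun x => key x x fun {T} hT t => (hi hT _).1 ⟨_, rfl⟩,
      fun a => key _ _ fun {T} hT t => by
        simpa using symm hT _ _ (hs' hT (t ≫ a)),
      fun a b hab => key _ _ fun {T} hT t => by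
        have h₁ := hs' hT (t ≫ a)
        have h₂ := hs' hT (t ≫ b)
        simp only [Category.assoc, reassoc_of% hab] at h₁ h₂ ⊢
        exact trans hT _ _ _ h₁ h₂⟩
  obtain ⟨W, q, n, hq, hn, rfl⟩ := ExactCategory.regEpiMonoFactorisation q'
  refine ⟨U₀, W, i, q, hq, fun {T} hT a => (hi hT a).2, fun {T} hT a b => ?_⟩
  rw [← hs hT]
  constructor
  · intro h
    obtain ⟨l, h₁, h₂⟩ := hq'.exists_lift a b (by rw [reassoc_of% h])
    exact ⟨l, by ext <;> simp [h₁, h₂]⟩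
  · rintro ⟨l, hl⟩
    rw [← cancel_mono n]
    have h := l ≫= hq'.w
    simp only [Category.assoc, reassoc_of% hl] at h
    simpa using h

end ProjectiveCover

/-- If `E` is exact with a projective cover `P`, and `P` has
right adjoints to weak pullback functors and full diagrams, then `E` is
cartesian closed. -/
theorem exact_cartesianClosed_of_fullDiagrams
    {E : Type u} [Category.{v} E] [ExactCategory E]
    (P : E → Prop) (hP : IsProjectiveCover P)
    (hadj : HasRightAdjointsToWeakPullbacksOn P)
    (hfull : HasFullDiagramsOn P) :
    IsCartesianClosed E := by
  intro A B
  obtain ⟨X, x, hX, -, hx⟩ := hP.exists_cover A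
  obtain ⟨Y, y, hY, -, hy⟩ := hP.exists_cover B
  obtain ⟨U, V, -, -, p₁, p₂, f, hV, hf⟩ := hfull hX hY
  -- `r a b` holds when `a` and `b` index the same functional relation from `A` to `B`.
  let r {T : E} (a b : T ⟶ U) : Prop := ∀ {S : E}, P S → ∀ (i : S ⟶ T) (v v' : S ⟶ V),
    v ≫ p₁ = i ≫ a → v' ≫ p₁ = i ≫ b → v ≫ p₂ ≫ x = v' ≫ p₂ ≫ x → v ≫ f ≫ y = v' ≫ f ≫ y
  obtain ⟨M, m, hm, hM⟩ := hadj.exists_forall hP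
    (equalizer.ι (pullback.fst (p₂ ≫ x) (p₂ ≫ x) ≫ f ≫ y) (pullback.snd _ _ ≫ f ≫ y))
    (prod.lift (pullback.fst _ _ ≫ p₁) (pullback.snd _ _ ≫ p₁))
  obtain ⟨U₀, W, i, q, hq, hi, hqi⟩ := hP.exists_subquotient r m
    (fun {T} hT a b => (hM hT _).trans ⟨fun h S hS j v v' hv hv' hvv => by
        obtain ⟨l, hl⟩ := h hS j (pullback.lift v v' hvv) (by ext <;> simp [hv, hv'])
        have := l ≫= equalizer.condition (pullback.fst (p₂ ≫ x) (p₂ ≫ x) ≫ f ≫ y)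
          (pullback.snd _ _ ≫ f ≫ y)
        simpa [reassoc_of% hl] using this,
      fun h S hS j k hk => by
        have h₁ := hk =≫ prod.fst
        have h₂ := hk =≫ prod.snd
        simp only [Category.assoc, prod.lift_fst, prod.lift_snd] at h₁ h₂
        exact ⟨equalizer.lift k (by
          simpa using h hS j (k ≫ pullback.fst _ _) (k ≫ pullback.snd _ _)
            (by simpa using h₁.symm) (by simpa using h₂.symm) (by simp [pullback.condition])),
          by simp⟩⟩)
    (fun hT a b h S hS j v v' hv hv' hvv => (h hS j v' v hv' hv hvv.symm).symm)
    (fun {T} hT a b c h h' S hS j v v' hv hv' hvv => by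
      obtain ⟨v₁, h₁, h₂⟩ := hV hS (j ≫ b) (v ≫ p₂)
      have h₃ : v ≫ p₂ ≫ x = v₁ ≫ p₂ ≫ x := by rw [reassoc_of% h₂]
      exact (h hS j v v₁ hv h₁ h₃).trans (h' hS j v₁ v' h₁ hv' (h₃.symm.trans hvv)))
  have hlift {T : E} (hT : P T) (w : T ⟶ W) := hP.1 hT q hq w
  have hlift' {T : E} (hT : P T) (u : T ⟶ U) (a : T ⟶ A) :
      ∃ v : T ⟶ V, v ≫ p₁ = u ∧ v ≫ p₂ ≫ x = a := by
    obtain ⟨a', rfl⟩ := hx hT a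
    obtain ⟨v, h₁, h₂⟩ := hV hT u a'
    exact ⟨v, h₁, by rw [reassoc_of% h₂]⟩
  obtain ⟨ev, hev⟩ := hP.exists_hom_of_functional (A := W ⨯ A) (B := B)
    (fun {T} c b => ∃ (u : T ⟶ U₀) (v : T ⟶ V), u ≫ q = c ≫ prod.fst ∧ v ≫ p₁ = u ≫ i ∧
      v ≫ p₂ ≫ x = c ≫ prod.snd ∧ v ≫ f ≫ y = b)
    (by
      rintro S T hS hT j c b ⟨u, v, h₁, h₂, h₃, h₄⟩
      exact ⟨j ≫ u, j ≫ v, by simp [h₁], by simp [h₂], by simp [h₃], by simp [h₄]⟩)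
    (fun {T} hT c => by
      obtain ⟨u, hu⟩ := hlift hT (c ≫ prod.fst)
      obtain ⟨v, h₁, h₂⟩ := hlift' hT (u ≫ i) (c ≫ prod.snd)
      exact ⟨_, u, v, hu, h₁, h₂, rfl⟩)
    (by
      rintro T hT c b b' ⟨u, v, h₁, h₂, h₃, rfl⟩ ⟨u', v', h₁', h₂', h₃', rfl⟩
      exact (hqi hT u u').1 (h₁.trans h₁'.symm) hT (𝟙 T) v v' (by simpa using h₂)
        (by simpa using h₂') (h₃.trans h₃'.symm))
  have hev' {T : E} (hT : P T) (u : T ⟶ U₀) (v : T ⟶ V) (hv : v ≫ p₁ = u ≫ i) :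
      prod.lift (u ≫ q) (v ≫ p₂ ≫ x) ≫ ev = v ≫ f ≫ y :=
    hev hT _ _ ⟨u, v, by simp, hv, by simp, rfl⟩
  refine ⟨W, ev, fun {Z} g => ?_⟩
  -- Every `P`-point of `Z` is tracked by some index in `U`.
  have track {T : E} (hT : P T) (z : T ⟶ Z) : ∃ u : T ⟶ U, ∀ {S : E}, P S →
      ∀ (j : S ⟶ T) (v : S ⟶ V), v ≫ p₁ = j ≫ u →
        v ≫ f ≫ y = prod.lift (j ≫ z) (v ≫ p₂ ≫ x) ≫ g := by
    obtain ⟨V', c, hV', -, hc⟩ := hP.exists_cover (pullback (prod.map z x ≫ g) y)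
    obtain ⟨u, Q, -, q₁, q₂, k, ⟨-, hQ⟩, h₁, h₂, h₃⟩ := hf hT hV'
      (c ≫ pullback.fst _ _ ≫ prod.fst) (c ≫ pullback.fst _ _ ≫ prod.snd)
      (c ≫ pullback.snd _ _) (fun {S} hS a b => by
        obtain ⟨d, hd⟩ := hy hS (prod.lift a b ≫ prod.map z x ≫ g)
        obtain ⟨e, he⟩ := hc hS (pullback.lift (prod.lift a b) d hd.symm)
        exact ⟨e, by rw [reassoc_of% he]; simp,
          by rw [reassoc_of% he]; simp⟩)
    refine ⟨u, fun {S} hS j v hv => ?_⟩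
    obtain ⟨t, rfl, rfl⟩ := hQ hS j v hv.symm
    rw [Category.assoc, ← reassoc_of% h₃, ← pullback.condition]
    simp only [← Category.assoc]
    congr 1
    ext
    · simp [← h₁]
    · simp [← reassoc_of% h₂]
  obtain ⟨h, hh⟩ := hP.exists_hom_of_functional (A := Z) (B := W)
    (fun {T} z w => ∃ u : T ⟶ U₀, u ≫ q = w ∧ ∀ {S : E}, P S →
      ∀ (j : S ⟶ T) (v : S ⟶ V), v ≫ p₁ = j ≫ u ≫ i →
        v ≫ f ≫ y = prod.lift (j ≫ z) (v ≫ p₂ ≫ x) ≫ g)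
    (by
      rintro S T hS hT j z w ⟨u, rfl, hu⟩
      refine ⟨j ≫ u, by simp, fun {S'} hS' j' v hv => ?_⟩
      simpa using hu hS' (j' ≫ j) v (by simpa using hv))
    (fun {T} hT z => by
      obtain ⟨u, hu⟩ := track hT z
      obtain ⟨u, rfl⟩ := hi hT u fun {S} hS j v v' hv hv' hvv => by
        rw [hu hS j v hv, hu hS j v' hv', hvv]
      exact ⟨_, u, rfl, hu⟩)
    (by
      rintro T hT z w w' ⟨u, rfl, hu⟩ ⟨u', rfl, hu'⟩
      exact (hqi hT u u').2 fun {S} hS j v v' hv hv' hvv => by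
        rw [hu hS j v hv, hu' hS j v' hv', hvv])
  have hg {T : E} (hT : P T) (z : T ⟶ Z) (a : T ⟶ A) :
      prod.lift (z ≫ h) a ≫ ev = prod.lift z a ≫ g := by
    obtain ⟨u, hu⟩ := track hT z
    obtain ⟨u, rfl⟩ := hi hT u fun {S} hS j v v' hv hv' hvv => by
      rw [hu hS j v hv, hu hS j v' hv', hvv]
    obtain ⟨v, hv, rfl⟩ := hlift' hT (u ≫ i) a
    rw [hh hT z (u ≫ q) ⟨u, rfl, hu⟩, hev' hT u v hv, hu hT (𝟙 T) v (by simpa using hv),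
      Category.id_comp]
  refine ⟨h, ?_, fun h' hh' => hP.hom_ext fun {T} hT z => ?_⟩
  · refine hP.hom_ext fun {T} hT c => ?_
    have h₁ := hg hT (c ≫ prod.fst) (c ≫ prod.snd)
    have h₂ : prod.lift (c ≫ prod.fst) (c ≫ prod.snd) = c := by
      ext <;> simp
    have h₃ : prod.lift ((c ≫ prod.fst) ≫ h) (c ≫ prod.snd) = c ≫ prod.map h (𝟙 A) := by
      ext <;> simp
    rwa [h₂, h₃, Category.assoc] at h₁
  · obtain ⟨u, hu⟩ := hlift hT (z ≫ h')
    obtain ⟨u', hu'⟩ := hlift hT (z ≫ h)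
    rw [← hu, ← hu', hqi hT]
    intro S hS j v v' hv hv' hvv
    have e₁ := hev' hS (j ≫ u) v (by simpa using hv)
    have e₂ := hev' hS (j ≫ u') v' (by simpa using hv')
    rw [Category.assoc, hu] at e₁
    rw [Category.assoc, hu', ← Category.assoc, hg hS] at e₂
    have e₃ : prod.lift (j ≫ z ≫ h') (v ≫ p₂ ≫ x) =
        prod.lift (j ≫ z) (v ≫ p₂ ≫ x) ≫ prod.map h' (𝟙 A) := by ext <;> simp
    rw [← e₁, ← e₂, ← hvv, ← hh', e₃, Category.assoc]

end Paper
end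

section
/- Let C be a category with weak finite limits. If C has dependent full diagrams (over every composable pair of morphisms), then C has full diagrams (from X to Y, for all objects X, Y). -/
open CategoryTheory CategoryTheory.Limits

universe v u v₂ u₂

namespace Paper

section WeakLimits

variable {C : Type u} [Category.{v} C]

lemma HasWeakFiniteLimits.exists_weakTerminal (hwfl : HasWeakFiniteLimits C) :
    ∃ T : C, ∀ W : C, Nonempty (W ⟶ T) := by
  obtain ⟨c, hc⟩ := hwfl (Discrete PEmpty) inferInstance inferInstance (Functor.empty C)
  refine ⟨c.pt, fun W => ?_⟩
  obtain ⟨t⟩ := hc (asEmptyCone W)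
  exact ⟨t.hom⟩

lemma HasWeakFiniteLimits.exists_isWeakProduct (hwfl : HasWeakFiniteLimits C) (Z X : C) :
    ∃ (V : C) (p₁ : V ⟶ Z) (p₂ : V ⟶ X), IsWeakProduct p₁ p₂ := by
  obtain ⟨c, hc⟩ := hwfl (Discrete WalkingPair) inferInstance inferInstance (pair Z X)
  refine ⟨c.pt, c.π.app ⟨.left⟩, c.π.app ⟨.right⟩, fun a b => ?_⟩
  obtain ⟨t⟩ := hc (BinaryFan.mk a b)
  exact ⟨t.hom, t.w ⟨.left⟩, t.w ⟨.right⟩⟩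

lemma HasWeakFiniteLimits.exists_isWeakPullback (hwfl : HasWeakFiniteLimits C) {A B Z : C}
    (f : A ⟶ Z) (g : B ⟶ Z) :
    ∃ (P : C) (q₁ : P ⟶ A) (q₂ : P ⟶ B), IsWeakPullback q₁ q₂ f g := by
  obtain ⟨c, hc⟩ := hwfl WalkingCospan inferInstance inferInstance (cospan f g)
  refine ⟨c.pt, c.π.app .left, c.π.app .right, PullbackCone.condition c, fun a b w => ?_⟩
  obtain ⟨t⟩ := hc (PullbackCone.mk a b w)
  exact ⟨t.hom, t.w .left, t.w .right⟩

lemma HasWeakFiniteLimits.exists_weakEqualizer (hwfl : HasWeakFiniteLimits C) {A B : C}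
    (f g : A ⟶ B) :
    ∃ (E : C) (e : E ⟶ A), e ≫ f = e ≫ g ∧
      ∀ {W : C} (a : W ⟶ A), a ≫ f = a ≫ g → ∃ t : W ⟶ E, t ≫ e = a := by
  obtain ⟨c, hc⟩ := hwfl WalkingParallelPair inferInstance inferInstance (parallelPair f g)
  refine ⟨c.pt, c.π.app .zero, Fork.condition c, fun a w => ?_⟩
  obtain ⟨t⟩ := hc (Fork.ofι a w)
  exact ⟨t.hom, t.w .zero⟩

/-- A weak limit of a pair of spans with common feet. -/
lemma HasWeakFiniteLimits.exists_weakJointPullback (hwfl : HasWeakFiniteLimits C)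
    {A B Z X : C} (a₁ : A ⟶ Z) (a₂ : A ⟶ X) (b₁ : B ⟶ Z) (b₂ : B ⟶ X) :
    ∃ (P : C) (r : P ⟶ A) (s : P ⟶ B), r ≫ a₁ = s ≫ b₁ ∧ r ≫ a₂ = s ≫ b₂ ∧
      ∀ {W : C} (a : W ⟶ A) (b : W ⟶ B), a ≫ a₁ = b ≫ b₁ → a ≫ a₂ = b ≫ b₂ →
        ∃ t : W ⟶ P, t ≫ r = a ∧ t ≫ s = b := by
  obtain ⟨Q, q₁, q₂, hq, hQ⟩ := hwfl.exists_isWeakPullback a₁ b₁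
  obtain ⟨E, e, he, hE⟩ := hwfl.exists_weakEqualizer (q₁ ≫ a₂) (q₂ ≫ b₂)
  refine ⟨E, e ≫ q₁, e ≫ q₂, by simp [hq], by simpa using he, fun a b w₁ w₂ => ?_⟩
  obtain ⟨t, rfl, rfl⟩ := hQ a b w₁
  obtain ⟨t, rfl⟩ := hE t (by simpa using w₂)
  exact ⟨t, by simp, by simp⟩

/-- Pulling back a weak product `T × X` along `u : U ⟶ T` gives a weak product `U × X`. -/
lemma IsWeakProduct.of_isWeakPullback {T X X' U V : C} {π₁ : X' ⟶ T} {π₂ : X' ⟶ X}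
    (hX' : IsWeakProduct π₁ π₂) {u : U ⟶ T} {p₁ : V ⟶ U} {p₂ : V ⟶ X'}
    (hV : IsWeakPullback p₁ p₂ u π₁) : IsWeakProduct p₁ (p₂ ≫ π₂) := by
  intro W a b
  obtain ⟨c, hc, rfl⟩ := hX' (a ≫ u) b
  obtain ⟨t, rfl, rfl⟩ := hV.2 a c hc.symm
  exact ⟨t, rfl, by simp⟩

lemma IsWeakPullback.symm {P A B Z : C} {q₁ : P ⟶ A} {q₂ : P ⟶ B} {f : A ⟶ Z} {g : B ⟶ Z}
    (hP : IsWeakPullback q₁ q₂ f g) : IsWeakPullback q₂ q₁ g f := by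
  refine ⟨hP.1.symm, fun a b w => ?_⟩
  obtain ⟨t, ht₁, ht₂⟩ := hP.2 b a w.symm
  exact ⟨t, ht₂, ht₁⟩

/-- A weak terminal object `T` need not be terminal, so a weak pullback over `X ⟶ T` need not be
a weak product; a dependent full diagram over a weak product `T × X ⟶ T` is used instead. -/
lemma IsDepFullDiagram.isFullDiagram (hwfl : HasWeakFiniteLimits C) {T X Y X' Y' U V : C}
    (hT : ∀ W : C, Nonempty (W ⟶ T)) {π₁ : X' ⟶ T} {π₂ : X' ⟶ X} (hX' : IsWeakProduct π₁ π₂)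
    {ρ₁ : Y' ⟶ X'} {ρ₂ : Y' ⟶ Y} (hY' : IsWeakProduct ρ₁ ρ₂)
    {u : U ⟶ T} {p₁ : V ⟶ U} {p₂ : V ⟶ X'} {f : V ⟶ Y'}
    (hV : IsDepFullDiagram π₁ ρ₁ u p₁ p₂ f) : IsFullDiagram p₁ (p₂ ≫ π₂) (f ≫ ρ₂) := by
  obtain ⟨hpb, hf, huniv⟩ := hV
  refine ⟨hX'.of_isWeakPullback hpb, fun {U' V'} p₁' p₂' f' hV' => ?_⟩
  obtain ⟨u'⟩ := hT U'
  obtain ⟨V'', r, s, hrs₁, hrs₂, hV''⟩ :=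
    hwfl.exists_weakJointPullback (p₁' ≫ u') p₂' π₁ π₂
  obtain ⟨f'', hf₁, hf₂⟩ := hY' s (r ≫ f')
  have hpb' : IsWeakPullback (r ≫ p₁') s u' π₁ := by
    refine ⟨by simpa using hrs₁, fun a b w => ?_⟩
    obtain ⟨t, rfl, ht₂⟩ := hV' a (b ≫ π₂)
    obtain ⟨t, rfl, rfl⟩ := hV'' t b (by simpa using w) ht₂
    exact ⟨t, by simp, rfl⟩
  obtain ⟨h, -, P, q₁, q₂, k, hP, hk, hkf⟩ := huniv u' (r ≫ p₁') s f'' hpb' hf₁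
  refine ⟨h, P, q₂, q₁, k ≫ r, hP.symm, by simpa using hk, ?_, ?_⟩
  · calc (k ≫ r) ≫ p₂' = (k ≫ f'') ≫ ρ₁ ≫ π₂ := by
          simp only [Category.assoc, hrs₂, reassoc_of% hf₁]
      _ = q₁ ≫ p₂ ≫ π₂ := by simp only [hkf, Category.assoc, reassoc_of% hf]
  · rw [Category.assoc, ← hf₂, ← Category.assoc, hkf, Category.assoc]

end WeakLimits

/-- A category with weak finite limits that has dependent full
diagrams has full diagrams. -/
theorem hasFullDiagrams_of_hasDepFullDiagrams
    {C : Type u} [Category.{v} C] (hwfl : HasWeakFiniteLimits C)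
    (h : HasDepFullDiagrams C) : HasFullDiagrams C := by
  intro X Y
  obtain ⟨T, hT⟩ := hwfl.exists_weakTerminal
  obtain ⟨X', π₁, π₂, hX'⟩ := hwfl.exists_isWeakProduct T X
  obtain ⟨Y', ρ₁, ρ₂, hY'⟩ := hwfl.exists_isWeakProduct X' Y
  obtain ⟨U, V, u, p₁, p₂, f, hV⟩ := h π₁ ρ₁
  exact ⟨U, V, p₁, p₂ ≫ π₂, f ≫ ρ₂, hV.isFullDiagram hwfl hT hX' hY'⟩

end Paper
end
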